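/- Let L ∈ ℂ^{p×p} be an invertible doubly real-preserving matrix. Suppose A, B ∈ K_p^{m×n} are orthogonally equivalent, i.e., A = Y *_L B *_L Z^⊤ for some orthogonal tubal matrices Y ∈ K_p^{m×m} and Z ∈ K_p^{n×n}. Then for every k = 1, …, p, the Hermitian matrices Φ_L(A)(k)^H Φ_L(A)(k) and Φ_L(B)(k)^H Φ_L(B)(k) have the same characteristic polynomial; in particular, the slices Φ_L(A)(k) and Φ_L(B)(k) have the same singular values. -/

import Mathlib

open Matrix Complex

/-- The `L`-product `a ⊙_L b := L⁻¹ ((L a) ∘ (L b))`, with `∘` the Hadamard product. -/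
noncomputable def odot {p : ℕ} (L : Matrix (Fin p) (Fin p) ℂ) (a b : Fin p → ℂ) :
    Fin p → ℂ :=
  L⁻¹ *ᵥ ((L *ᵥ a) * (L *ᵥ b))

/-- Embedding of a real vector into `ℂ^p`. -/
def toC {p : ℕ} (a : Fin p → ℝ) : Fin p → ℂ := fun i => (a i : ℂ)

/-- A complex vector is real if all its components have zero imaginary part. -/
def IsRealVec {p : ℕ} (v : Fin p → ℂ) : Prop := ∀ k, (v k).im = 0

/-- `L` is real-preserving if `a ⊙_L b` is real whenever `a, b` are real. -/
def RealPreserving {p : ℕ} (L : Matrix (Fin p) (Fin p) ℂ) : Prop :=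
  ∀ a b : Fin p → ℝ, IsRealVec (odot L (toC a) (toC b))

/-- The map `ψ_L(a) := L⁻¹ (conj (L a))`, with entrywise complex conjugation. -/
noncomputable def psiL {p : ℕ} (L : Matrix (Fin p) (Fin p) ℂ) (a : Fin p → ℂ) : Fin p → ℂ :=
  L⁻¹ *ᵥ (star (L *ᵥ a))

/-- `L` is doubly real-preserving if it is real-preserving and `ψ_L` maps `ℝ^p` to `ℝ^p`. -/
def DoublyRealPreserving {p : ℕ} (L : Matrix (Fin p) (Fin p) ℂ) : Prop :=
  RealPreserving L ∧ ∀ a : Fin p → ℝ, IsRealVec (psiL L (toC a))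

/-- The unit tubal scalar `e_L := L⁻¹ 𝟙`, where `𝟙` is the all-ones vector. -/
noncomputable def unitE {p : ℕ} (L : Matrix (Fin p) (Fin p) ℂ) : Fin p → ℂ :=
  L⁻¹ *ᵥ (fun _ => 1)

/-- The tubal matrix product `A *_L B`, with `(i,j)` entry `Σ_l a_{il} ⊙_L b_{lj}`. -/
noncomputable def tprodC {p m s n : ℕ} (L : Matrix (Fin p) (Fin p) ℂ)
    (A : Fin m → Fin s → Fin p → ℂ) (B : Fin s → Fin n → Fin p → ℂ) :
    Fin m → Fin n → Fin p → ℂ :=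
  fun i j => ∑ l, odot L (A i l) (B l j)

/-- The `k`-th slice `Φ_L(A)(k)`: the matrix with `(i,j)` entry the `k`-th component of
`L a_{ij}`. -/
noncomputable def sliceC {p m n : ℕ} (L : Matrix (Fin p) (Fin p) ℂ)
    (A : Fin m → Fin n → Fin p → ℂ) (k : Fin p) : Matrix (Fin m) (Fin n) ℂ :=
  Matrix.of fun i j => (L *ᵥ A i j) k

/-- Entrywise embedding of a real tubal matrix into the complex setting. -/
def mapC {p m n : ℕ} (A : Fin m → Fin n → Fin p → ℝ) : Fin m → Fin n → Fin p → ℂ :=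
  fun i j => toC (A i j)

/-- The transpose of a tubal matrix: `(A^⊤)_{ij} = ψ_L(a_{ji})`. -/
noncomputable def transC {p m n : ℕ} (L : Matrix (Fin p) (Fin p) ℂ)
    (A : Fin m → Fin n → Fin p → ℂ) : Fin n → Fin m → Fin p → ℂ :=
  fun i j => psiL L (A j i)

/-- The identity tubal matrix: diagonal with diagonal entries `e_L`. -/
noncomputable def idC {p : ℕ} (L : Matrix (Fin p) (Fin p) ℂ) (n : ℕ) :
    Fin n → Fin n → Fin p → ℂ :=
  fun i j => if i = j then unitE L else 0

/-- A tubal matrix `A` is orthogonal if `A *_L A^⊤ = A^⊤ *_L A = I`. -/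
noncomputable def OrthTubalC {p n : ℕ} (L : Matrix (Fin p) (Fin p) ℂ)
    (A : Fin n → Fin n → Fin p → ℂ) : Prop :=
  tprodC L A (transC L A) = idC L n ∧ tprodC L (transC L A) A = idC L n

theorem mulVec_inv_mulVec {p : ℕ} {L : Matrix (Fin p) (Fin p) ℂ} (hL : IsUnit L.det)
    (v : Fin p → ℂ) : L *ᵥ (L⁻¹ *ᵥ v) = v := by
  rw [mulVec_mulVec, mul_nonsing_inv _ hL, one_mulVec]

theorem sliceC_tprodC {p m s n : ℕ} {L : Matrix (Fin p) (Fin p) ℂ} (hL : IsUnit L.det)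
    (A : Fin m → Fin s → Fin p → ℂ) (B : Fin s → Fin n → Fin p → ℂ) (k : Fin p) :
    sliceC L (tprodC L A B) k = sliceC L A k * sliceC L B k := by
  ext i j
  simp [sliceC, tprodC, odot, mulVec_sum, mulVec_inv_mulVec hL, mul_apply]

theorem sliceC_transC {p m n : ℕ} {L : Matrix (Fin p) (Fin p) ℂ} (hL : IsUnit L.det)
    (A : Fin m → Fin n → Fin p → ℂ) (k : Fin p) :
    sliceC L (transC L A) k = (sliceC L A k)ᴴ := by
  ext i j
  simp [sliceC, transC, psiL, mulVec_inv_mulVec hL]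

theorem sliceC_idC {p n : ℕ} {L : Matrix (Fin p) (Fin p) ℂ} (hL : IsUnit L.det) (k : Fin p) :
    sliceC L (idC L n) k = 1 := by
  ext i j
  by_cases h : i = j <;> simp [sliceC, idC, unitE, mulVec_inv_mulVec hL, h, one_apply]

theorem OrthTubalC.conjTranspose_sliceC_mul_self {p n : ℕ} {L : Matrix (Fin p) (Fin p) ℂ}
    (hL : IsUnit L.det) {A : Fin n → Fin n → Fin p → ℂ} (hA : OrthTubalC L A) (k : Fin p) :
    (sliceC L A k)ᴴ * sliceC L A k = 1 := by
  rw [← sliceC_transC hL, ← sliceC_tprodC hL, hA.2, sliceC_idC hL]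

/-- The Gram matrix of `Y B Zᴴ` has the same characteristic polynomial as that of `B` when the
columns of `Y` and of `Z` are orthonormal. -/
theorem charpoly_gram_mul_mul_conjTranspose {m n : ℕ} {Y : Matrix (Fin m) (Fin m) ℂ}
    {Z : Matrix (Fin n) (Fin n) ℂ} (B : Matrix (Fin m) (Fin n) ℂ)
    (hY : Yᴴ * Y = 1) (hZ : Zᴴ * Z = 1) :
    ((Y * B * Zᴴ)ᴴ * (Y * B * Zᴴ)).charpoly = (Bᴴ * B).charpoly := by
  have h : (Y * B * Zᴴ)ᴴ * (Y * B * Zᴴ) = Z * (Bᴴ * (Yᴴ * Y) * B * Zᴴ) := by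
    simp only [conjTranspose_mul, conjTranspose_conjTranspose, Matrix.mul_assoc]
  rw [h, hY, Matrix.mul_one, charpoly_mul_comm, Matrix.mul_assoc, hZ, Matrix.mul_one]

/-- Theorem 2.9: if `A` and `B` are orthogonally equivalent (`A = Y *_L B *_L Z^⊤` with
`Y, Z` orthogonal tubal matrices), then for every `k` the Hermitian matrices
`Φ_L(A)(k)^H Φ_L(A)(k)` and `Φ_L(B)(k)^H Φ_L(B)(k)` have the same characteristic
polynomial; in particular the slices have the same singular values. -/
theorem stmt11 {p m n : ℕ} (L : Matrix (Fin p) (Fin p) ℂ) (hL : IsUnit L.det)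
    (hD : DoublyRealPreserving L) (A B : Fin m → Fin n → Fin p → ℝ)
    (Y : Fin m → Fin m → Fin p → ℝ) (Z : Fin n → Fin n → Fin p → ℝ)
    (hY : OrthTubalC L (mapC Y)) (hZ : OrthTubalC L (mapC Z))
    (hEq : mapC A = tprodC L (tprodC L (mapC Y) (mapC B)) (transC L (mapC Z))) :
    ∀ k : Fin p,
      ((sliceC L (mapC A) k)ᴴ * sliceC L (mapC A) k).charpoly
        = ((sliceC L (mapC B) k)ᴴ * sliceC L (mapC B) k).charpoly := by
  intro k
  rw [hEq, sliceC_tprodC hL, sliceC_tprodC hL, sliceC_transC hL]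
  exact charpoly_gram_mul_mul_conjTranspose _ (hY.conjTranspose_sliceC_mul_self hL k)
    (hZ.conjTranspose_sliceC_mul_self hL k)
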